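/- (Inductive characterization of admissibility.) Let S be a non-empty finite set and x an S-cube in an abelian category. The following are equivalent: (1) x is admissible; (2) for some s ∈ S: (i) both s-faces x|_{S∖{s}}^{{s}} and x|_{S∖{s}}^{∅} are admissible, (ii) the boundary morphism d_{T∪{s}}^{x,s} is a monomorphism for every T ⊆ S∖{s}, and (iii) H_0^s(x) is admissible; (3) conditions (i), (ii), (iii) hold for every s ∈ S. -/

import Mathlib

open CategoryTheory CategoryTheory.Limits Opposite

attribute [local instance] CategoryTheory.Abelian.hasFiniteBiproducts

set_option linter.unusedSectionVars false

universe w v u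

/-- An `ι`-cube in a category `𝒜`: a contravariant functor from the poset of finite
subsets of `ι` (ordered by inclusion) to `𝒜`.  An `S`-cube (for `S : Finset ι`) is such a
functor, of which only the values on subsets of `S` are relevant. -/
abbrev Cube (𝒜 : Type u) [Category.{v} 𝒜] (ι : Type w) := (Finset ι)ᵒᵖ ⥤ 𝒜

namespace Cube

variable {𝒜 : Type u} [Category.{v} 𝒜] {ι : Type w} [DecidableEq ι]

/-- The vertex `x_T` of a cube `x` at a finite subset `T`. -/
def vtx (x : Cube 𝒜 ι) (T : Finset ι) : 𝒜 := x.obj (op T)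

/-- The structure morphism `x_T ⟶ x_U` of a cube for `U ⊆ T`. -/
def mapLE (x : Cube 𝒜 ι) {T U : Finset ι} (h : U ⊆ T) : x.vtx T ⟶ x.vtx U :=
  x.map (homOfLE h).op

lemma mapLE_refl (x : Cube 𝒜 ι) (T : Finset ι) (h : T ⊆ T) : x.mapLE h = 𝟙 (x.vtx T) := by
  show x.map (homOfLE h).op = _
  rw [show (homOfLE h).op = 𝟙 (op T) from rfl, x.map_id]; rfl

lemma mapLE_comp (x : Cube 𝒜 ι) {T U V : Finset ι} (h1 : U ⊆ T) (h2 : V ⊆ U) :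
    x.mapLE h1 ≫ x.mapLE h2 = x.mapLE (h2.trans h1) := by
  show x.map _ ≫ x.map _ = x.map _
  rw [← x.map_comp]
  rfl

/-- The `k`-direction boundary morphism `d^k_T : x_T ⟶ x_{T ∖ {k}}` of a cube. -/
def bd (x : Cube 𝒜 ι) (T : Finset ι) (k : ι) : x.vtx T ⟶ x.vtx (T.erase k) :=
  x.mapLE (Finset.erase_subset k T)

/-- The `k`-direction `0`-th homology `H⁰ₖ(x)` of a cube in an abelian category, an
`(S ∖ {k})`-cube: its vertex at `T` is the cokernel of the boundary morphism
`d^k_{T ∪ {k}} : x_{T ∪ {k}} ⟶ x_{(T ∪ {k}) ∖ {k}}`. -/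
noncomputable def H0 [Abelian 𝒜] (x : Cube 𝒜 ι) (k : ι) : Cube 𝒜 ι where
  obj T := cokernel (x.bd (insert k T.unop) k)
  map {T U} f :=
    cokernel.map _ _
      (x.mapLE (Finset.insert_subset_insert k (leOfHom f.unop)))
      (x.mapLE (Finset.erase_subset_erase k (Finset.insert_subset_insert k (leOfHom f.unop))))
      (by rw [bd, bd, mapLE_comp, mapLE_comp])
  map_id T := by
    apply coequalizer.hom_ext
    simp [cokernel.map]
    rw [mapLE_refl]
    simp
  map_comp {T U V} f g := by
    apply coequalizer.hom_ext
    simp [cokernel.map]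
    rw [← Category.assoc, mapLE_comp]

/-- Admissibility of an `S`-cube `x` in an abelian category, by recursion on `#S`:
`x` is admissible if all its boundary morphisms `d^k_T` (`k ∈ T ⊆ S`) are monomorphisms and
for every `k ∈ S` the `(S ∖ {k})`-cube `H⁰ₖ(x)` is admissible.  (For `S = ∅` the conditions
are vacuous, and for `#S = 1` this says exactly that the boundary morphism of `x` is a
monomorphism.) -/
def Admissible [Abelian 𝒜] (x : Cube 𝒜 ι) (S : Finset ι) : Prop :=
  (∀ T ⊆ S, ∀ k ∈ T, Mono (x.bd T k)) ∧
  ∀ k, (hk : k ∈ S) → Admissible (x.H0 k) (S.erase k)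
termination_by S.card
decreasing_by exact Finset.card_erase_lt_of_mem hk

/-- Iterated `0`-th homology:
`H0s x [i₁, …, i_r] = H⁰_{i₁}(H⁰_{i₂}(⋯(H⁰_{i_r}(x))⋯))`. -/
noncomputable def H0s [Abelian 𝒜] (x : Cube 𝒜 ι) : List ι → Cube 𝒜 ι
  | [] => x
  | k :: ks => (x.H0s ks).H0 k

/-- The restriction `x|_U^V` of a cube to `U` along `V` (for disjoint `U`, `V`): the
`U`-cube `T ↦ x_{T ∪ V}`.  (It is implemented as the cube `T ↦ x_{(T ∩ U) ∪ V}`, whose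
vertex at any subset `T ⊆ U` is exactly `x_{T ∪ V}`.) -/
def res (x : Cube 𝒜 ι) (U V : Finset ι) : Cube 𝒜 ι :=
  (Monotone.functor (f := fun T : Finset ι => (T ∩ U) ∪ V)
    (fun _ _ h => Finset.union_subset_union (Finset.inter_subset_inter h (subset_refl U))
      (subset_refl V))).op ⋙ x

end Cube

namespace Cube

variable {𝒜 : Type u} [Category.{v} 𝒜] {ι : Type w} [DecidableEq ι]

lemma mono_congr (x : Cube 𝒜 ι) {T U T' U' : Finset ι} (hT : T = T') (hU : U = U')
    (h : U ⊆ T) (h' : U' ⊆ T') (H : Mono (x.mapLE h)) : Mono (x.mapLE h') := by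
  subst hT hU; exact H

section ab
variable [Abelian 𝒜]

lemma erase_insert_sub (k : ι) (T : Finset ι) : (insert k T).erase k ⊆ T := by
  intro a; simp +contextual

/-- The cokernel projection. -/
noncomputable def cp (x : Cube 𝒜 ι) (k : ι) (T : Finset ι) :
    x.vtx ((insert k T).erase k) ⟶ (x.H0 k).vtx T :=
  cokernel.π (x.bd (insert k T) k)

lemma cp_nat (x : Cube 𝒜 ι) (k : ι) {T U : Finset ι} (h : U ⊆ T) :
    x.cp k T ≫ (x.H0 k).mapLE h =
      x.mapLE (Finset.erase_subset_erase k (Finset.insert_subset_insert k h)) ≫ x.cp k U :=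
  cokernel.π_desc (x.bd (insert k T) k) _ _

lemma cp_zero (x : Cube 𝒜 ι) (k : ι) (T : Finset ι) :
    x.mapLE (Finset.erase_subset k (insert k T)) ≫ x.cp k T = 0 :=
  cokernel.condition (x.bd (insert k T) k)

lemma cp_desc (x : Cube 𝒜 ι) (k : ι) (T : Finset ι) {Z : 𝒜}
    (f : x.vtx ((insert k T).erase k) ⟶ Z)
    (hf : x.mapLE (Finset.erase_subset k (insert k T)) ≫ f = 0) :
    ∃ g : (x.H0 k).vtx T ⟶ Z, x.cp k T ≫ g = f :=
  ⟨cokernel.desc (x.bd (insert k T) k) f hf, cokernel.π_desc (x.bd (insert k T) k) f hf⟩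

/-- The projection from a cube to its zeroth homology. -/
noncomputable def pr (x : Cube 𝒜 ι) (k : ι) (T : Finset ι) : x.vtx T ⟶ (x.H0 k).vtx T :=
  x.mapLE (erase_insert_sub k T) ≫ x.cp k T

lemma pr_nat (x : Cube 𝒜 ι) (k : ι) {T U : Finset ι} (h : U ⊆ T) :
    x.pr k T ≫ (x.H0 k).mapLE h = x.mapLE h ≫ x.pr k U := by
  rw [pr, pr, Category.assoc, cp_nat, ← Category.assoc, ← Category.assoc,
    mapLE_comp, mapLE_comp]

lemma pr_zero (x : Cube 𝒜 ι) (k : ι) {T U : Finset ι} (h : T ⊆ U) (hk : k ∈ U) :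
    x.mapLE h ≫ x.pr k T = 0 := by
  have h1 : insert k T ⊆ U := Finset.insert_subset hk h
  rw [pr, ← Category.assoc, mapLE_comp,
    ← mapLE_comp x h1 (Finset.erase_subset k (insert k T)), Category.assoc, cp_zero, comp_zero]

lemma pr_exists_desc (x : Cube 𝒜 ι) (k : ι) (T : Finset ι) (hk : k ∉ T) {Z : 𝒜}
    (f : x.vtx T ⟶ Z) (hf : x.mapLE (Finset.subset_insert k T) ≫ f = 0) :
    ∃ g : (x.H0 k).vtx T ⟶ Z, x.pr k T ≫ g = f := by
  have h : T ⊆ (insert k T).erase k := by rw [Finset.erase_insert hk]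
  obtain ⟨g, hg⟩ := x.cp_desc k T (x.mapLE h ≫ f) (by rw [← Category.assoc, mapLE_comp, hf])
  refine ⟨g, ?_⟩
  rw [pr, Category.assoc, hg, ← Category.assoc, mapLE_comp, mapLE_refl, Category.id_comp]

/-- A chosen descent along the projection. -/
noncomputable def dsc (x : Cube 𝒜 ι) (k : ι) (T : Finset ι) (hk : k ∉ T) {Z : 𝒜}
    (f : x.vtx T ⟶ Z) (hf : x.mapLE (Finset.subset_insert k T) ≫ f = 0) :
    (x.H0 k).vtx T ⟶ Z := (x.pr_exists_desc k T hk f hf).choose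

lemma pr_dsc (x : Cube 𝒜 ι) (k : ι) (T : Finset ι) (hk : k ∉ T) {Z : 𝒜}
    (f : x.vtx T ⟶ Z) (hf : x.mapLE (Finset.subset_insert k T) ≫ f = 0) :
    x.pr k T ≫ x.dsc k T hk f hf = f := (x.pr_exists_desc k T hk f hf).choose_spec

lemma pr_epi (x : Cube 𝒜 ι) (k : ι) (T : Finset ι) (hk : k ∉ T) : Epi (x.pr k T) := by
  have h : T ⊆ (insert k T).erase k := by rw [Finset.erase_insert hk]
  have : IsIso (x.mapLE (erase_insert_sub k T)) :=
    ⟨x.mapLE h, by rw [mapLE_comp, mapLE_refl], by rw [mapLE_comp, mapLE_refl]⟩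
  have h2 : Epi (cokernel.π (x.bd (insert k T) k)) := inferInstance
  exact epi_comp' (inferInstance) h2

lemma pr_exact (x : Cube 𝒜 ι) (k : ι) (T : Finset ι) (hk : k ∉ T) :
    (ShortComplex.mk (x.mapLE (Finset.subset_insert k T)) (x.pr k T)
      (x.pr_zero k _ (Finset.mem_insert_self k T))).Exact := by
  have := x.pr_epi k T hk
  apply ShortComplex.exact_of_g_is_cokernel
  exact CokernelCofork.IsColimit.ofπ _ _ (fun f hf => x.dsc k T hk f hf)
    (fun f hf => x.pr_dsc k T hk f hf)
    (fun f hf m hm => by rw [← cancel_epi (x.pr k T), pr_dsc, hm])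

/-- `y` is isomorphic, on subsets of `U`, to the face `x|_U^V`. -/
structure FI (y x : Cube 𝒜 ι) (U V : Finset ι) where
  /-- forward map -/
  hom : ∀ T W : Finset ι, T ⊆ U → W = T ∪ V → (y.vtx T ⟶ x.vtx W)
  /-- inverse map -/
  inv : ∀ T W : Finset ι, T ⊆ U → W = T ∪ V → (x.vtx W ⟶ y.vtx T)
  hom_inv : ∀ T W hT hW, hom T W hT hW ≫ inv T W hT hW = 𝟙 _
  inv_hom : ∀ T W hT hW, inv T W hT hW ≫ hom T W hT hW = 𝟙 _
  nat : ∀ T W hT hW T' W' hT' hW' (h : T' ⊆ T) (h' : W' ⊆ W),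
    y.mapLE h ≫ hom T' W' hT' hW' = hom T W hT hW ≫ x.mapLE h'

lemma FI.nat' {y x : Cube 𝒜 ι} {U V : Finset ι} (F : FI y x U V) (T W hT hW T' W' hT' hW')
    (h : T' ⊆ T) (h' : W' ⊆ W) :
    x.mapLE h' ≫ F.inv T' W' hT' hW' = F.inv T W hT hW ≫ y.mapLE h := by
  have := F.nat T W hT hW T' W' hT' hW' h h'
  calc _ = (F.inv T W hT hW ≫ F.hom T W hT hW) ≫ x.mapLE h' ≫ F.inv T' W' hT' hW' := by
        rw [F.inv_hom, Category.id_comp]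
    _ = F.inv T W hT hW ≫ (F.hom T W hT hW ≫ x.mapLE h') ≫ F.inv T' W' hT' hW' := by
        simp only [Category.assoc]
    _ = _ := by rw [← this, Category.assoc, F.hom_inv, Category.comp_id]

lemma FI.mono_iff {y x : Cube 𝒜 ι} {U V : Finset ι} (F : FI y x U V) (T W) (hT : T ⊆ U)
    (hW : W = T ∪ V) (T' W') (hT' : T' ⊆ U) (hW' : W' = T' ∪ V) (h : T' ⊆ T) (h' : W' ⊆ W) :
    Mono (y.mapLE h) ↔ Mono (x.mapLE h') := by
  have i1 : IsIso (F.hom T W hT hW) := ⟨F.inv T W hT hW, F.hom_inv _ _ _ _, F.inv_hom _ _ _ _⟩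
  have i2 : IsIso (F.hom T' W' hT' hW') := ⟨F.inv T' W' hT' hW', F.hom_inv _ _ _ _, F.inv_hom _ _ _ _⟩
  have := F.nat T W hT hW T' W' hT' hW' h h'
  constructor
  · intro H
    have : x.mapLE h' = CategoryTheory.inv (F.hom T W hT hW) ≫ y.mapLE h ≫ F.hom T' W' hT' hW' := by
      rw [this]; simp
    rw [this]; infer_instance
  · intro H
    have : y.mapLE h = F.hom T W hT hW ≫ x.mapLE h' ≫ CategoryTheory.inv (F.hom T' W' hT' hW') := by
      rw [← Category.assoc, ← this]; simp
    rw [this]; infer_instance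

/-- Zeroth homology of a face isomorphism. -/
noncomputable def FI.H0 {y x : Cube 𝒜 ι} {U V : Finset ι} (F : FI y x U V) (k : ι) (hk : k ∈ U)
    (hV : k ∉ V) : FI (y.H0 k) (x.H0 k) (U.erase k) V where
  hom T W hT hW := y.dsc k T (fun h => by simpa using hT h)
    (F.hom T W (hT.trans (Finset.erase_subset _ _)) hW ≫ x.pr k W) (by
      rw [← Category.assoc, F.nat (insert k T) (insert k W)
        (Finset.insert_subset hk (hT.trans (Finset.erase_subset _ _)))
        (by rw [hW, Finset.insert_union]) T W _ _ _ (Finset.subset_insert k W), Category.assoc,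
        pr_zero _ _ _ (Finset.mem_insert_self _ _), comp_zero])
  inv T W hT hW := x.dsc k W (fun h => by
      rw [hW, Finset.mem_union] at h; exact h.elim (fun h => by simpa using hT h) hV)
    (F.inv T W (hT.trans (Finset.erase_subset _ _)) hW ≫ y.pr k T) (by
      rw [← Category.assoc, F.nat' (insert k T) (insert k W)
        (Finset.insert_subset hk (hT.trans (Finset.erase_subset _ _)))
        (by rw [hW, Finset.insert_union]) T W _ _ (Finset.subset_insert k T) _, Category.assoc,
        pr_zero _ _ _ (Finset.mem_insert_self _ _), comp_zero])
  hom_inv T W hT hW := by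
    have := y.pr_epi k T (fun h => by simpa using hT h)
    rw [← cancel_epi (y.pr k T), ← Category.assoc, pr_dsc, Category.assoc, pr_dsc,
      ← Category.assoc, F.hom_inv]; simp
  inv_hom T W hT hW := by
    have := x.pr_epi k W (fun h => by
      rw [hW, Finset.mem_union] at h; exact h.elim (fun h => by simpa using hT h) hV)
    rw [← cancel_epi (x.pr k W), ← Category.assoc, pr_dsc, Category.assoc, pr_dsc,
      ← Category.assoc, F.inv_hom]; simp
  nat T W hT hW T' W' hT' hW' h h' := by
    have := y.pr_epi k T (fun h => by simpa using hT h)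
    rw [← cancel_epi (y.pr k T), ← Category.assoc, pr_nat, Category.assoc, pr_dsc,
      ← Category.assoc, F.nat T W (hT.trans (Finset.erase_subset _ _)) hW _ _ _ _ h h',
      ← Category.assoc (y.pr k T), pr_dsc, Category.assoc, Category.assoc, pr_nat]

/-- One direction of the interchange of two zeroth homologies. -/
noncomputable def swp (x : Cube 𝒜 ι) (s k : ι) (hsk : s ≠ k) (T : Finset ι) (hs : s ∉ T)
    (hk : k ∉ T) : ((x.H0 s).H0 k).vtx T ⟶ ((x.H0 k).H0 s).vtx T :=
  (x.H0 s).dsc k T hk (x.dsc s T hs (x.pr k T ≫ (x.H0 k).pr s T) (by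
      rw [← Category.assoc, ← pr_nat, Category.assoc, pr_zero _ _ _ (Finset.mem_insert_self _ _),
        comp_zero])) (by
    have := x.pr_epi s (insert k T) (by simp [hsk, hs])
    rw [← cancel_epi (x.pr s (insert k T)), ← Category.assoc, pr_nat, Category.assoc, pr_dsc,
      ← Category.assoc, pr_zero _ _ _ (Finset.mem_insert_self _ _), zero_comp, comp_zero])

lemma pr_swp (x : Cube 𝒜 ι) (s k : ι) (hsk : s ≠ k) (T : Finset ι) (hs : s ∉ T)
    (hk : k ∉ T) : x.pr s T ≫ (x.H0 s).pr k T ≫ x.swp s k hsk T hs hk =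
      x.pr k T ≫ (x.H0 k).pr s T := by
  rw [swp, pr_dsc, pr_dsc]

lemma hom_ext2 (x : Cube 𝒜 ι) (s k : ι) (T : Finset ι) (hs : s ∉ T)
    (hk : k ∉ T) {Z : 𝒜} (f g : ((x.H0 s).H0 k).vtx T ⟶ Z)
    (h : x.pr s T ≫ (x.H0 s).pr k T ≫ f = x.pr s T ≫ (x.H0 s).pr k T ≫ g) : f = g := by
  have := x.pr_epi s T hs
  have := (x.H0 s).pr_epi k T hk
  rwa [cancel_epi, cancel_epi] at h

lemma swp_swp (x : Cube 𝒜 ι) (s k : ι) (hsk : s ≠ k) (T : Finset ι) (hs : s ∉ T)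
    (hk : k ∉ T) : x.swp s k hsk T hs hk ≫ x.swp k s hsk.symm T hk hs = 𝟙 _ := by
  apply hom_ext2 x s k T hs hk
  have h1 := x.pr_swp s k hsk T hs hk
  have h2 := x.pr_swp k s hsk.symm T hk hs
  rw [Category.comp_id, ← h2]
  simp only [← Category.assoc] at h1 ⊢
  rw [h1]

lemma swp_nat (x : Cube 𝒜 ι) (s k : ι) (hsk : s ≠ k) (T : Finset ι) (hs : s ∉ T)
    (hk : k ∉ T) (T' : Finset ι) (hs' : s ∉ T') (hk' : k ∉ T') (h : T' ⊆ T) :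
    ((x.H0 s).H0 k).mapLE h ≫ x.swp s k hsk T' hs' hk' =
      x.swp s k hsk T hs hk ≫ ((x.H0 k).H0 s).mapLE h := by
  apply hom_ext2 x s k T hs hk
  have h1 := x.pr_swp s k hsk T hs hk
  have h2 := x.pr_swp s k hsk T' hs' hk'
  calc _ = x.pr s T ≫ ((x.H0 s).pr k T ≫ ((x.H0 s).H0 k).mapLE h) ≫ x.swp s k hsk T' hs' hk' := by
        simp only [Category.assoc]
    _ = (x.pr s T ≫ (x.H0 s).mapLE h) ≫ (x.H0 s).pr k T' ≫ x.swp s k hsk T' hs' hk' := by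
        rw [pr_nat]; simp only [Category.assoc]
    _ = x.mapLE h ≫ x.pr k T' ≫ (x.H0 k).pr s T' := by
        rw [pr_nat, Category.assoc, h2]
    _ = (x.pr k T ≫ (x.H0 k).pr s T) ≫ ((x.H0 k).H0 s).mapLE h := by
        rw [Category.assoc, pr_nat, ← Category.assoc, ← Category.assoc, pr_nat]
    _ = _ := by rw [← h1]; simp only [Category.assoc]

/-- The interchange isomorphism. -/
noncomputable def FI.swap (x : Cube 𝒜 ι) (s k : ι) (hsk : s ≠ k) (U : Finset ι) (hs : s ∉ U)
    (hk : k ∉ U) : FI ((x.H0 s).H0 k) ((x.H0 k).H0 s) U ∅ where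
  hom T W hT hW := x.swp s k hsk T (fun h => hs (hT h)) (fun h => hk (hT h)) ≫
    Cube.mapLE _ (by simp [hW])
  inv T W hT hW := Cube.mapLE _ (by simp [hW]) ≫
    x.swp k s hsk.symm T (fun h => hk (hT h)) (fun h => hs (hT h))
  hom_inv T W hT hW := by
    rw [Finset.union_empty] at hW
    subst hW
    simp [mapLE_refl, swp_swp]
  inv_hom T W hT hW := by
    rw [Finset.union_empty] at hW
    subst hW
    simp [mapLE_refl, swp_swp]
  nat T W hT hW T' W' hT' hW' h h' := by
    rw [Finset.union_empty] at hW hW'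
    subst hW hW'
    simp [mapLE_refl, swp_nat x s k hsk W (fun h => hs (hT h)) (fun h => hk (hT h))]

/-- A restriction is a face. -/
def FI.res (x : Cube 𝒜 ι) (U V : Finset ι) : FI (x.res U V) x U V where
  hom T W hT hW := x.mapLE (T := (T ∩ U) ∪ V) (by rw [hW, Finset.inter_eq_left.2 hT])
  inv T W hT hW := x.mapLE (U := (T ∩ U) ∪ V) (by rw [hW, Finset.inter_eq_left.2 hT])
  hom_inv T W hT hW := (mapLE_comp x (T := (T ∩ U) ∪ V) _ _).trans (mapLE_refl x _ _)
  inv_hom T W hT hW := (mapLE_comp x (U := (T ∩ U) ∪ V) _ _).trans (mapLE_refl x _ _)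
  nat T W hT hW T' W' hT' hW' h h' := by
    exact (mapLE_comp x (T := (T ∩ U) ∪ V) (U := (T' ∩ U) ∪ V)
      (Finset.union_subset_union (Finset.inter_subset_inter h (subset_refl U))
      (subset_refl V)) _).trans (mapLE_comp x (T := (T ∩ U) ∪ V) _ h').symm

lemma FI.admissible (n : ℕ) : ∀ {y x : Cube 𝒜 ι} {U V S : Finset ι} (_ : FI y x U V)
    (_ : U.card = n) (_ : U ∪ V ⊆ S) (_ : Disjoint U V) (_ : x.Admissible S),
    y.Admissible U := by
  induction n with
  | zero =>
    intro y x U V S F hn hS hd hx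
    rw [Finset.card_eq_zero] at hn
    subst hn
    rw [Admissible]
    refine ⟨fun T hT k hk => ?_, fun k hk => ?_⟩
    · exact absurd (hT hk) (by simp)
    · exact absurd hk (by simp)
  | succ n ih =>
    intro y x U V S F hn hS hd hx
    rw [Admissible] at hx ⊢
    refine ⟨fun T hT k hk => ?_, fun k hk => ?_⟩
    · have hkV : k ∉ V := Finset.disjoint_left.1 hd (hT hk)
      refine (F.mono_iff T (T ∪ V) hT rfl (T.erase k) ((T ∪ V).erase k)
        ((Finset.erase_subset _ _).trans hT) ?_ _ (Finset.erase_subset _ _)).2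
        (hx.1 (T ∪ V) ((Finset.union_subset_union hT (subset_refl V)).trans hS) k (by simp [hk]))
      rw [Finset.erase_union_distrib, Finset.erase_eq_of_notMem hkV]
    · have hkV : k ∉ V := Finset.disjoint_left.1 hd hk
      refine ih (F.H0 k hk hkV) (by rw [Finset.card_erase_of_mem hk, hn]; rfl) ?_
        (hd.mono_left (Finset.erase_subset _ _)) (hx.2 k (hS (by simp [hk])))
      intro a ha
      have : a ≠ k := by
        rintro rfl
        simp [hkV] at ha
      refine Finset.mem_erase.2 ⟨this, hS ?_⟩
      simp at ha ⊢
      tauto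

lemma sq_mono (x : Cube 𝒜 ι) (s k : ι) (hsk : s ≠ k) (T : Finset ι) (hs : s ∉ T)
    (hk : k ∉ T) (h1 : Mono (x.mapLE (Finset.subset_insert s T)))
    (h2 : Mono ((x.H0 s).mapLE (Finset.subset_insert k T))) :
    Mono ((x.H0 k).mapLE (Finset.subset_insert s T)) := by
  have hks : k ∉ insert s T := by simp [hsk.symm, hk]
  have hsk' : s ∉ insert k T := by simp [hsk, hs]
  have e1 := x.pr_epi k (insert s T) hks
  apply Preadditive.mono_of_cancel_zero
  intro Z z hz
  obtain ⟨Z1, p1, hp1, c, hc⟩ := surjective_up_to_refinements_of_epi (x.pr k (insert s T)) z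
  have hd : (c ≫ x.mapLE (Finset.subset_insert s T)) ≫ x.pr k T = 0 := by
    rw [Category.assoc, ← pr_nat, ← Category.assoc, ← hc, Category.assoc, hz, comp_zero]
  obtain ⟨Z2, p2, hp2, b, hb⟩ := (x.pr_exact k T hk).exact_up_to_refinements _ hd
  dsimp at b hb
  have hb0 : b ≫ x.pr s (insert k T) = 0 := by
    rw [← cancel_mono ((x.H0 s).mapLE (Finset.subset_insert k T)), Category.assoc, pr_nat,
      ← Category.assoc, ← hb]
    simp only [Category.assoc]
    rw [pr_zero _ _ _ (Finset.mem_insert_self _ _)]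
    simp
  obtain ⟨Z3, p3, hp3, a, ha⟩ := (x.pr_exact s (insert k T) hsk').exact_up_to_refinements _ hb0
  dsimp at a ha
  have hsub : insert s T ⊆ insert s (insert k T) :=
    Finset.insert_subset_insert _ (Finset.subset_insert _ _)
  have hca : p3 ≫ p2 ≫ c = a ≫ x.mapLE hsub := by
    rw [← cancel_mono (x.mapLE (Finset.subset_insert s T))]
    simp only [Category.assoc]
    rw [hb, ← Category.assoc, ha, Category.assoc, mapLE_comp, mapLE_comp]
  rw [← cancel_epi p1, ← cancel_epi p2, ← cancel_epi p3, hc]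
  calc _ = (p3 ≫ p2 ≫ c) ≫ x.pr k (insert s T) := by simp only [Category.assoc]
    _ = 0 := by rw [hca, Category.assoc, pr_zero _ _ _ (by simp), comp_zero]
    _ = _ := by simp

lemma admissible_of_faces (n : ℕ) : ∀ {x y z : Cube 𝒜 ι} {S : Finset ι} {s : ι}
    (_ : S.card = n) (_ : s ∈ S) (_ : FI y x (S.erase s) {s}) (_ : FI z x (S.erase s) ∅)
    (_ : y.Admissible (S.erase s)) (_ : z.Admissible (S.erase s))
    (_ : ∀ T ⊆ S.erase s, Mono (x.mapLE (Finset.subset_insert s T)))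
    (_ : (x.H0 s).Admissible (S.erase s)), x.Admissible S := by
  induction n with
  | zero =>
    intro x y z S s hn hs
    rw [Finset.card_eq_zero] at hn
    simp [hn] at hs
  | succ n ih =>
    intro x y z S s hn hs F G hy hz hm hH
    have hy' := hy
    have hz' := hz
    have hH' := hH
    rw [Admissible] at hy' hz' hH' ⊢
    refine ⟨fun T hT k hk => ?_, fun k hk => ?_⟩
    · by_cases hks : k = s
      · subst hks
        exact x.mono_congr (Finset.insert_erase hk) rfl _ _
          (hm (T.erase k) (Finset.erase_subset_erase _ hT))
      · by_cases hsT : s ∈ T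
        · refine (F.mono_iff (T.erase s) T (Finset.erase_subset_erase _ hT) ?_
            ((T.erase s).erase k) (T.erase k)
            ((Finset.erase_subset _ _).trans (Finset.erase_subset_erase _ hT)) ?_
            (Finset.erase_subset _ _) _).1
            (hy'.1 (T.erase s) (Finset.erase_subset_erase _ hT) k (by simp [hk, hks]))
          · ext a; by_cases a = s <;> simp_all
          · ext a; by_cases a = s <;> simp_all [eq_comm]
        · have hT' : T ⊆ S.erase s := fun a ha =>
            Finset.mem_erase.2 ⟨fun h => hsT (h ▸ ha), hT ha⟩
          exact (G.mono_iff T T hT' (by simp) (T.erase k) (T.erase k)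
            ((Finset.erase_subset _ _).trans hT') (by simp) (Finset.erase_subset _ _) _).1
            (hz'.1 T hT' k hk)
    · by_cases hks : k = s
      · subst hks; exact hH
      · have hkS : k ∈ S.erase s := by simp [hk, hks]
        have F' := F.H0 k hkS (by simpa using hks)
        have G' := G.H0 k hkS (by simp)
        have hy2 := hy'.2 k hkS
        have hz2 := hz'.2 k hkS
        have hH2 := hH'.2 k hkS
        rw [Finset.erase_right_comm] at F' G' hy2 hz2 hH2
        refine ih (s := s) (by rw [Finset.card_erase_of_mem hk, hn]; rfl)
          (Finset.mem_erase.2 ⟨Ne.symm hks, hs⟩) F' G' hy2 hz2 ?_ ?_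
        · intro T hT
          have hsT : s ∉ T := fun h => by simpa using hT h
          have hkT : k ∉ T := fun h => by simpa using hT h
          have hT2 : T ⊆ S.erase s := fun a ha => by
            have := hT ha
            simp at this ⊢
            tauto
          refine x.sq_mono s k (Ne.symm hks) T hsT hkT (hm T hT2) ?_
          exact mono_congr _ rfl (Finset.erase_insert hkT) _ _
            (hH'.1 (insert k T) (Finset.insert_subset hkS hT2) k (Finset.mem_insert_self _ _))
        · exact FI.admissible _ (FI.swap x k s hks ((S.erase k).erase s) (by simp) (by simp)) rfl
            (by simp) (by simp) hH2

end ab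

end Cube

/-- **inductive characterization of admissibility.** For a nonempty finite
`S` and an `S`-cube `x` in an abelian category, the following are equivalent:
(1) `x` is admissible;
(2) for some `s ∈ S`: (i) both `s`-faces of `x` are admissible, (ii) `d^s_{T ∪ {s}}` is a
monomorphism for every `T ⊆ S ∖ {s}`, and (iii) `H⁰ₛ(x)` is admissible;
(3) the conditions of (2) hold for every `s ∈ S`. -/
theorem admissible_inductive_characterization {𝒜 : Type u} [Category.{v} 𝒜] [Abelian 𝒜]
    {ι : Type w} [DecidableEq ι] (x : Cube 𝒜 ι) (S : Finset ι) (hS : S.Nonempty) :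
    (x.Admissible S ↔ ∃ s ∈ S,
      ((x.res (S.erase s) {s}).Admissible (S.erase s) ∧
        (x.res (S.erase s) ∅).Admissible (S.erase s)) ∧
      (∀ T ⊆ S.erase s, Mono (x.bd (insert s T) s)) ∧
      (x.H0 s).Admissible (S.erase s)) ∧
    (x.Admissible S ↔ ∀ s ∈ S,
      ((x.res (S.erase s) {s}).Admissible (S.erase s) ∧
        (x.res (S.erase s) ∅).Admissible (S.erase s)) ∧
      (∀ T ⊆ S.erase s, Mono (x.bd (insert s T) s)) ∧
      (x.H0 s).Admissible (S.erase s)) := by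
  have key1 : x.Admissible S → ∀ s ∈ S,
      ((x.res (S.erase s) {s}).Admissible (S.erase s) ∧
        (x.res (S.erase s) ∅).Admissible (S.erase s)) ∧
      (∀ T ⊆ S.erase s, Mono (x.bd (insert s T) s)) ∧
      (x.H0 s).Admissible (S.erase s) := by
    intro hx s hs
    refine ⟨⟨?_, ?_⟩, ?_, ?_⟩
    · refine Cube.FI.admissible _ (Cube.FI.res x (S.erase s) {s}) rfl ?_ (by simp) hx
      exact Finset.union_subset (Finset.erase_subset _ _) (by simpa using hs)
    · exact Cube.FI.admissible _ (Cube.FI.res x (S.erase s) ∅) rfl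
        (by simpa using Finset.erase_subset _ _) (by simp) hx
    · rw [Cube.Admissible] at hx
      exact fun T hT => hx.1 _ (Finset.insert_subset hs (hT.trans (Finset.erase_subset _ _))) s
        (Finset.mem_insert_self _ _)
    · rw [Cube.Admissible] at hx
      exact hx.2 s hs
  have key2 : (∃ s ∈ S,
      ((x.res (S.erase s) {s}).Admissible (S.erase s) ∧
        (x.res (S.erase s) ∅).Admissible (S.erase s)) ∧
      (∀ T ⊆ S.erase s, Mono (x.bd (insert s T) s)) ∧
      (x.H0 s).Admissible (S.erase s)) → x.Admissible S := by
    rintro ⟨s, hs, ⟨hy, hz⟩, hm, hH⟩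
    refine Cube.admissible_of_faces _ rfl hs (Cube.FI.res x _ _) (Cube.FI.res x _ _) hy hz ?_ hH
    intro T hT
    exact Cube.mono_congr _ rfl (Finset.erase_insert (fun h => by simpa using hT h)) _ _ (hm T hT)
  obtain ⟨s, hs⟩ := hS
  exact ⟨⟨fun h => ⟨s, hs, key1 h s hs⟩, key2⟩, ⟨key1, fun h => key2 ⟨s, hs, h s hs⟩⟩⟩
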